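/- (Full MacMahon formula.) Let a, b, c be nonnegative integers and let P(a,b,c) be the set of plane partitions inside the a×b×c box, i.e., arrays (π_{i,j})_{1≤i≤a, 1≤j≤b} of integers with 0 ≤ π_{i,j} ≤ c, weakly decreasing in i and in j. Then Σ_{π∈P(a,b,c)} q^{|π|} · ∏_{i=1}^{a} ∏_{j=1}^{b} (1 − q^{i+j−1}) = ∏_{i=1}^{a} ∏_{j=1}^{b} (1 − q^{i+j+c−1}) as polynomials in ℤ[q]; equivalently Σ_{π∈P(a,b,c)} q^{|π|} = ∏_{i=1}^{a} ∏_{j=1}^{b} (1 − q^{i+j+c−1}) / (1 − q^{i+j−1}). -/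

import Mathlib

open Finset PowerSeries

noncomputable section

/-- The size of a plane partition supported in the `a × b` rectangle. -/
def ppSize (a b : ℕ) (π : ℕ → ℕ → ℕ) : ℕ := ∑ i ∈ range a, ∑ j ∈ range b, π i j

/-- A plane partition inside the `a×b×c` box, encoded as a doubly indexed family
(0-indexed: `π i j` is the entry `π_{i+1,j+1}`) that vanishes outside the `a × b`
rectangle, has entries `≤ c`, and is weakly decreasing in each argument. -/
def IsBoxPP (a b c : ℕ) (π : ℕ → ℕ → ℕ) : Prop :=
  (∀ i j, π i (j + 1) ≤ π i j) ∧ (∀ i j, π (i + 1) j ≤ π i j) ∧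
  (∀ i j, π i j ≤ c) ∧ (∀ i j, a ≤ i ∨ b ≤ j → π i j = 0)


lemma vand_diff {R : Type*} [CommRing R] (n : ℕ) (y : Fin (n+1) → R) :
    (Matrix.of fun i j : Fin n => y i.succ ^ (j.val+1) - y i.castSucc ^ (j.val+1)).det
      = (Matrix.vandermonde y).det := by
  rw [Matrix.det_eq_of_forall_row_eq_smul_add_pred (A := Matrix.vandermonde y)
    (B := Matrix.of fun i j => Fin.cases (Matrix.vandermonde y 0 j)
      (fun i : Fin n => Matrix.vandermonde y i.succ j - Matrix.vandermonde y i.castSucc j) i)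
    (fun _ => 1)]
  · rw [Matrix.det_succ_column_zero, Fin.sum_univ_succ]
    simp [Matrix.vandermonde_apply]
    congr 1
  · intro j; simp
  · intro i j; simp

lemma row_sum {R : Type*} [CommRing R] (q : R) (n : ℕ) (l : Fin (n+1) → ℕ) (hl : Antitone l) :
    (∑ m ∈ Fintype.piFinset (fun i : Fin n => Ico (l i.succ) (l i.castSucc)),
      (∏ i, q ^ m i) * (Matrix.vandermonde (fun i => q ^ m i)).det) * ∏ j ∈ range n, (1 - q^(j+1))
      = (Matrix.vandermonde (fun i => q ^ l i)).det := by
  rw [← vand_diff]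
  have h1 : ∀ m : Fin n → ℕ, (∏ i, q ^ m i) * (Matrix.vandermonde (fun i => q ^ m i)).det
      = (Matrix.detRowAlternating (R := R) (n := Fin n)).toMultilinearMap
        (fun i j => (q ^ m i)^(j.val+1)) := by
    intro m
    rw [← Matrix.det_mul_column]
    change _ = Matrix.det _
    congr 1
    ext i j
    simp [Matrix.vandermonde_apply, pow_succ']
  rw [Finset.sum_congr rfl (fun m _ => h1 m)]
  rw [← MultilinearMap.map_sum_finset (Matrix.detRowAlternating (R := R) (n := Fin n)).toMultilinearMap
    (fun i (k : ℕ) (j : Fin n) => (q ^ k)^(j.val+1))]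
  rw [mul_comm, Finset.prod_range]
  change _ * Matrix.det (Matrix.of fun i j =>
    (∑ k ∈ Ico (l i.succ) (l i.castSucc), fun j : Fin n => (q ^ k)^(j.val+1)) j) = _
  rw [← Matrix.det_mul_row]
  congr 1
  ext i j
  simp only [Matrix.of_apply, Finset.sum_apply]
  have hle : l i.succ ≤ l i.castSucc := hl (Fin.castSucc_lt_succ).le
  generalize l i.castSucc = t at hle ⊢
  induction t, hle using Nat.le_induction with
  | base => simp
  | succ k hk ih =>
    rw [Finset.sum_Ico_succ_top hk, mul_add, ih]
    ring

def extF {n : ℕ} (l : Fin n → ℕ) : ℕ → ℕ := fun i => if h : i < n then l ⟨i, h⟩ else 0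

def gT : (n : ℕ) → (Fin n → ℕ) → Finset (ℕ → ℕ → ℕ)
  | 0, _ => {0}
  | n+1, l => by
    classical
    exact (Fintype.piFinset (fun i : Fin n => Ico (l i.succ) (l i.castSucc))).biUnion fun m =>
      (gT n m).image (fun x => Function.update x (n+1) (extF l))

lemma mem_gT (n : ℕ) (l : Fin n → ℕ) (x : ℕ → ℕ → ℕ) : x ∈ gT n l ↔
    (∀ i : Fin n, x n i = l i) ∧
    (∀ k < n, ∀ i < k, x (k+1) (i+1) ≤ x k i ∧ x k i < x (k+1) i) ∧
    (∀ k i, (n < k ∨ k ≤ i) → x k i = 0) := by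
  induction n generalizing x with
  | zero =>
    simp only [gT, Finset.mem_singleton]
    constructor
    · rintro rfl; simp
    · rintro ⟨-, -, h⟩
      funext k i
      exact h k i (by omega)
  | succ n ih =>
    simp only [gT, Finset.mem_biUnion, Finset.mem_image, Fintype.mem_piFinset, Finset.mem_Ico, ih]
    constructor
    · rintro ⟨m, hm, y, ⟨h1, h2, h3⟩, rfl⟩
      refine ⟨?_, ?_, ?_⟩
      · intro i; simp [extF]; intro h; have := i.2; omega
      · intro k hk i hi
        rcases Nat.lt_succ_iff_lt_or_eq.mp hk with hk | rfl
        · rw [Function.update_of_ne (by omega), Function.update_of_ne (by omega)]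
          exact h2 k hk i hi
        · rw [Function.update_self, Function.update_of_ne (by omega)]
          have := hm ⟨i, hi⟩
          rw [h1 ⟨i, hi⟩] 
          simpa [extF, hi, Nat.lt_succ_of_lt hi] using this
      · intro k i h
        by_cases hk : k = n+1
        · subst hk
          rw [Function.update_self]
          simp [extF]; intro; omega
        · rw [Function.update_of_ne hk]
          exact h3 k i (by omega)
    · rintro ⟨h1, h2, h3⟩
      refine ⟨fun i => x n i, ?_, Function.update x (n+1) 0, ⟨?_, ?_, ?_⟩, ?_⟩
      · intro i
        have := h2 n (by omega) i i.2
        rw [← h1, ← h1]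
        simpa using this
      · intro i; rw [Function.update_of_ne (by omega)]
      · intro k hk i hi
        rw [Function.update_of_ne (by omega), Function.update_of_ne (by omega)]
        exact h2 k (by omega) i hi
      · intro k i h
        by_cases hk : k = n+1
        · subst hk
          rw [Function.update_self]; rfl
        · rw [Function.update_of_ne hk]
          exact h3 k i (by omega)
      · rw [Function.update_idem]
        convert Function.update_eq_self (n+1) x
        funext i
        unfold extF
        split_ifs with h
        · rw [← h1]
        · rw [h3 _ _ (by omega)]

def gwt (n : ℕ) (x : ℕ → ℕ → ℕ) : ℕ := ∑ k ∈ range (n+1), ∑ i ∈ range k, x k i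

lemma gT_sum {R : Type*} [CommRing R] (q : R) (n : ℕ) (l : Fin n → ℕ) (hl : Antitone l) :
    (∑ x ∈ gT n l, q ^ gwt n x) * ∏ k ∈ range n, ∏ j ∈ range k, (1 - q^(j+1))
      = (∏ i, q ^ l i) * (Matrix.vandermonde (fun i => q ^ l i)).det := by
  induction n with
  | zero => simp [gT, gwt]
  | succ n ih =>
    rw [← row_sum q n l hl]
    have hs : ∑ x ∈ gT (n+1) l, q ^ gwt (n+1) x =
        ∑ m ∈ Fintype.piFinset (fun i : Fin n => Ico (l i.succ) (l i.castSucc)),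
          ∑ x ∈ gT n m, (∏ i, q ^ l i) * q ^ gwt n x := by
      classical
      rw [gT, Finset.sum_biUnion]
      · refine Finset.sum_congr rfl fun m hm => ?_
        rw [Finset.sum_image]
        · refine Finset.sum_congr rfl fun x hx => ?_
          rw [gwt, Finset.sum_range_succ, pow_add, mul_comm]
          congr 1
          · rw [Function.update_self, Finset.sum_range, Finset.prod_pow_eq_pow_sum]
            congr 1
            refine Finset.sum_congr rfl fun i _ => ?_
            simp [extF]; intro h; have := i.2; omega
          · congr 1
            refine Finset.sum_congr rfl fun k hk => ?_
            rw [Function.update_of_ne]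
            have := Finset.mem_range.mp hk
            omega
        · intro x hx y hy hxy
          have hx3 := ((mem_gT _ _ _).mp hx).2.2
          have hy3 := ((mem_gT _ _ _).mp hy).2.2
          funext k i
          by_cases hk : k = n+1
          · rw [hx3 k i (by omega), hy3 k i (by omega)]
          · have := congrFun (congrFun hxy k) i
            simpa [Function.update_of_ne hk] using this
      · intro m hm m' hm' hne
        rw [Function.onFun, Finset.disjoint_left]
        intro z hz hz'
        obtain ⟨x, hx, rfl⟩ := Finset.mem_image.mp hz
        obtain ⟨y, hy, hxy⟩ := Finset.mem_image.mp hz'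
        have hx1 := ((mem_gT _ _ _).mp hx).1
        have hy1 := ((mem_gT _ _ _).mp hy).1
        apply hne
        funext i
        rw [← hx1, ← hy1]
        have := congrFun (congrFun hxy n) i
        simpa using this.symm
    rw [hs, Finset.prod_range_succ, Finset.sum_mul, Finset.sum_mul, Finset.mul_sum]
    refine Finset.sum_congr rfl fun m hm => ?_
    have hm' : Antitone m := by
      rw [Fintype.mem_piFinset] at hm
      intro i j hij
      rcases hij.lt_or_eq with h | rfl
      · have h1 := Finset.mem_Ico.mp (hm i)
        have h2 := Finset.mem_Ico.mp (hm j)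
        have : l j.castSucc ≤ l i.succ := hl (by
          rw [Fin.le_def]; simp; omega)
        omega
      · exact le_rfl
    rw [← ih m hm', ← Finset.mul_sum]
    ring

def ppMap (a b c : ℕ) (π : ℕ → ℕ → ℕ) : ℕ → ℕ → ℕ := fun k i =>
  if i < k ∧ k ≤ a + b then
    (if i + (a + b - k) < a then c else π i (i + b - k)) + (k - 1 - i) else 0

def ppInv (a b : ℕ) (x : ℕ → ℕ → ℕ) : ℕ → ℕ → ℕ := fun i j =>
  if i < a ∧ j < b then x (b + i - j) i - (b - j - 1) else 0

def topRow (a b c : ℕ) : Fin (a+b) → ℕ := fun i => (if i.val < a then c else 0) + (a + b - 1 - i)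

lemma topRow_anti (a b c : ℕ) : Antitone (topRow a b c) := by
  intro i j h
  have := Fin.le_def.mp h
  unfold topRow
  split_ifs <;> omega

lemma ppMap_pos (a b c : ℕ) (π : ℕ → ℕ → ℕ) {k i : ℕ} (h : i < k) (h' : k ≤ a + b) :
    ppMap a b c π k i =
    (if i + (a + b - k) < a then c else π i (i + b - k)) + (k - 1 - i) := if_pos ⟨h, h'⟩

lemma ppMap_mem (a b c : ℕ) (π : ℕ → ℕ → ℕ) (h : IsBoxPP a b c π) :
    ppMap a b c π ∈ gT (a+b) (topRow a b c) := by
  obtain ⟨h1, h2, h3, h4⟩ := h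
  rw [mem_gT]
  refine ⟨?_, ?_, ?_⟩
  · intro i
    have := i.2
    unfold ppMap topRow
    rw [if_pos (by omega)]
    congr 1
    split_ifs <;> first | omega | rfl | (apply h4; omega)
  · intro k hk i hi
    rw [ppMap_pos a b c π hi hk.le, ppMap_pos a b c π (show i < k + 1 by omega) hk,
      ppMap_pos a b c π (show i + 1 < k + 1 by omega) hk]
    constructor
    · by_cases hh : i + (a + b - k) < a
      · rw [if_pos hh, if_pos (by omega)]; omega
      · rw [if_neg hh, if_neg (by omega)]
        have := h2 i (i + b - k)
        have e : i + 1 + b - (k+1) = i + b - k := by omega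
        rw [e]
        omega
    · by_cases hh : i + (a + b - k) < a
      · rw [if_pos hh, if_pos (by omega)]; omega
      · rw [if_neg hh]
        by_cases hh' : i + (a + b - (k+1)) < a
        · rw [if_pos hh']
          have := h3 i (i + b - k)
          omega
        · rw [if_neg hh']
          have := h1 i (i + b - (k+1))
          have e : i + b - (k+1) + 1 = i + b - k := by omega
          rw [e] at this
          omega
  · intro k i h
    unfold ppMap
    rw [if_neg (by omega)]

section
variable {a b c : ℕ} {x : ℕ → ℕ → ℕ}

lemma gT_low (hx : x ∈ gT (a+b) (topRow a b c)) (d : ℕ) : ∀ k i, k = i + 1 + d → k ≤ a + b →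
    d ≤ x k i := by
  obtain ⟨-, h2, -⟩ := (mem_gT _ _ _).mp hx
  induction d with
  | zero => simp
  | succ d ih =>
    intro k i hk hn
    have := ih (k-1) i (by omega) (by omega)
    have h := h2 (k-1) (by omega) i (by omega)
    rw [Nat.sub_add_cancel (by omega)] at h
    omega

lemma gT_top (hx : x ∈ gT (a+b) (topRow a b c)) (i : ℕ) (hi : i < a + b) :
    x (a+b) i = (if i < a then c else 0) + (a + b - 1 - i) :=
  ((mem_gT _ _ _).mp hx).1 ⟨i, hi⟩

lemma gT_up (hx : x ∈ gT (a+b) (topRow a b c)) (d : ℕ) : ∀ k i, k + d = a + b → i < k →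
    x k i ≤ c + (k - 1 - i) ∧ (i + d < a → c + (k-1-i) ≤ x k i) ∧ (a ≤ i → x k i ≤ k-1-i) := by
  obtain ⟨-, h2, -⟩ := (mem_gT _ _ _).mp hx
  induction d with
  | zero =>
    intro k i hk hi
    obtain rfl : k = a + b := by omega
    rw [gT_top hx i hi]
    split_ifs <;> omega
  | succ d ih =>
    intro k i hk hi
    have h3 := ih (k+1) i (by omega) (by omega)
    have h4 := ih (k+1) (i+1) (by omega) (by omega)
    have h := h2 k (by omega) i (by omega)
    refine ⟨by omega, fun _ => ?_, fun _ => ?_⟩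
    · have := h4.2.1 (by omega); omega
    · have := h3.2.2 (by omega); omega

lemma ppInv_mem (hx : x ∈ gT (a+b) (topRow a b c)) : IsBoxPP a b c (ppInv a b x) := by
  obtain ⟨-, h2, -⟩ := (mem_gT _ _ _).mp hx
  refine ⟨?_, ?_, ?_, ?_⟩
  · intro i j
    unfold ppInv
    by_cases h : i < a ∧ j + 1 < b
    · rw [if_pos h, if_pos (by omega)]
      have := h2 (b + i - (j+1)) (by omega) i (by omega)
      have e : b + i - (j+1) + 1 = b + i - j := by omega
      rw [e] at this
      omega
    · rw [if_neg h]; omega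
  · intro i j
    unfold ppInv
    by_cases h : i + 1 < a ∧ j < b
    · rw [if_pos h, if_pos (by omega)]
      have := h2 (b + i - j) (by omega) i (by omega)
      have e : b + i - j + 1 = b + (i + 1) - j := by omega
      rw [e] at this
      omega
    · rw [if_neg h]; omega
  · intro i j
    unfold ppInv
    split_ifs with h
    · have := (gT_up hx (a + b - (b + i - j)) (b+i-j) i (by omega) (by omega)).1
      omega
    · omega
  · intro i j h
    unfold ppInv
    rw [if_neg (by omega)]

lemma ppMap_inv (hx : x ∈ gT (a+b) (topRow a b c)) : ppMap a b c (ppInv a b x) = x := by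
  obtain ⟨-, -, h3⟩ := (mem_gT _ _ _).mp hx
  funext k i
  unfold ppMap
  by_cases h : i < k ∧ k ≤ a + b
  · rw [if_pos h]
    obtain ⟨u1, u2, u3⟩ := gT_up hx (a+b-k) k i (by omega) (by omega)
    have l1 := gT_low hx (k-1-i) k i (by omega) (by omega)
    by_cases hh : i + (a + b - k) < a
    · rw [if_pos hh]; have := u2 hh; omega
    · rw [if_neg hh]
      unfold ppInv
      by_cases hi : i < a
      · rw [if_pos (by omega)]
        have e : b + i - (i + b - k) = k := by omega
        rw [e]; omega
      · rw [if_neg (by omega)]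
        have := u3 (by omega); omega
  · rw [if_neg h, h3 k i (by omega)]

lemma ppInv_map (π : ℕ → ℕ → ℕ) (h : IsBoxPP a b c π) : ppInv a b (ppMap a b c π) = π := by
  obtain ⟨-, -, -, h4⟩ := h
  funext i j
  unfold ppInv
  split_ifs with hh
  · unfold ppMap
    rw [if_pos (by omega), if_neg (by omega)]
    have e : i + b - (b + i - j) = j := by omega
    rw [e]; omega
  · rw [h4 i j (by omega)]

lemma ppMap_wt (π : ℕ → ℕ → ℕ) (h : IsBoxPP a b c π) :
    gwt (a+b) (ppMap a b c π) = gwt (a+b) (ppMap a b c 0) + ppSize a b π := by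
  obtain ⟨-, -, -, h4⟩ := h
  have key : ∑ k ∈ range (a+b+1), ∑ i ∈ range k,
      (if i + (a + b - k) < a then 0 else π i (i + b - k)) = ppSize a b π := by
    unfold ppSize
    rw [Finset.sum_sigma', Finset.sum_sigma']
    refine (Finset.sum_bij_ne_zero (fun (p : (_ : ℕ) × ℕ) _ _ => (⟨b + p.1 - p.2, p.1⟩ : (_ : ℕ) × ℕ))
      ?_ ?_ ?_ ?_).symm
    · rintro ⟨i, j⟩ h _
      simp only [mem_sigma, mem_range] at h ⊢
      omega
    · rintro ⟨i, j⟩ h _ ⟨i', j'⟩ h' _ e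
      simp only [mem_sigma, mem_range, Sigma.mk.injEq, heq_eq_eq] at h h' e ⊢
      omega
    · rintro ⟨k, i⟩ h hne
      simp only [mem_sigma, mem_range] at h hne
      by_cases hh : i + (a + b - k) < a
      · simp [hh] at hne
      rw [if_neg hh] at hne
      by_cases hi : i < a
      · refine ⟨⟨i, i + b - k⟩, ?_, hne, ?_⟩
        · simp only [mem_sigma, mem_range]; omega
        · simp only [Sigma.mk.injEq, heq_eq_eq, and_true]; omega
      · exact absurd (h4 _ _ (by omega)) hne
    · rintro ⟨i, j⟩ h _
      simp only [mem_sigma, mem_range] at h ⊢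
      rw [if_neg (by omega)]
      congr 1; omega
  rw [← key]
  unfold gwt
  rw [← Finset.sum_add_distrib]
  refine Finset.sum_congr rfl fun k hk => ?_
  rw [← Finset.sum_add_distrib]
  refine Finset.sum_congr rfl fun i hi => ?_
  simp only [mem_range] at hk hi
  rw [ppMap_pos a b c _ hi (by omega), ppMap_pos a b c _ hi (by omega)]
  split_ifs
  · omega
  · simp only [Pi.zero_apply]; omega

end

lemma pp_finite (a b c : ℕ) : {π | IsBoxPP a b c π}.Finite :=
  Set.Finite.of_injOn (f := ppMap a b c) (t := (gT (a+b) (topRow a b c) : Set _))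
    (fun π h => ppMap_mem a b c π h)
    (fun π h π' h' e => by rw [← ppInv_map π h, ← ppInv_map π' h', e]) (Finset.finite_toSet _)

def ppGF (a b c : ℕ) : PowerSeries ℤ := PowerSeries.mk fun n =>
        (Nat.card {π : ℕ → ℕ → ℕ // IsBoxPP a b c π ∧ ppSize a b π = n} : ℤ)

lemma ppGF_eq (a b c : ℕ) : ppGF a b c = ∑ π ∈ (pp_finite a b c).toFinset, X ^ ppSize a b π := by
  classical
  ext n
  rw [ppGF, coeff_mk, map_sum]
  simp only [coeff_X_pow]
  rw [Finset.sum_boole]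
  congr 1
  rw [← Nat.subtype_card ((pp_finite a b c).toFinset.filter (fun π => n = ppSize a b π))]
  intro π
  simp [eq_comm]

lemma ppGF_det (a b c : ℕ) :
    X ^ gwt (a+b) (ppMap a b c 0) * ppGF a b c * 
      ∏ k ∈ range (a+b), ∏ j ∈ range k, (1 - (X : PowerSeries ℤ)^(j+1))
    = (∏ i, (X : PowerSeries ℤ) ^ topRow a b c i) *
      (Matrix.vandermonde (fun i => X ^ topRow a b c i)).det := by
  rw [← gT_sum X _ _ (topRow_anti a b c), ppGF_eq, Finset.mul_sum]
  congr 1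
  refine Finset.sum_bij' (fun π _ => ppMap a b c π) (fun x _ => ppInv a b x) ?_ ?_ ?_ ?_ ?_
  · intro π h
    exact ppMap_mem a b c π (by simpa using h)
  · intro x h
    simpa using ppInv_mem h
  · intro π h
    exact ppInv_map (c := c) π (by simpa using h)
  · intro x h
    exact ppMap_inv h
  · intro π h
    rw [ppMap_wt π (by simpa using h), pow_add]

lemma ppGF_const (a b c : ℕ) : constantCoeff (ppGF a b c) = 1 := by
  rw [← coeff_zero_eq_constantCoeff_apply, ppGF, coeff_mk]
  have : Nat.card {π : ℕ → ℕ → ℕ // IsBoxPP a b c π ∧ ppSize a b π = 0} = 1 := by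
    rw [Nat.card_eq_one_iff_exists]
    refine ⟨⟨0, ⟨by simp, by simp, by simp, by simp⟩, by simp [ppSize]⟩, ?_⟩
    rintro ⟨π, ⟨_, _, _, h4⟩, h⟩
    apply Subtype.ext
    funext i j
    by_cases hh : i < a ∧ j < b
    · simp only [ppSize, Finset.sum_eq_zero_iff, mem_range] at h
      exact h i hh.1 j hh.2
    · exact h4 i j (by omega)
  rw [this]; rfl

lemma ppGF_zero (a b : ℕ) : ppGF a b 0 = 1 := by
  have : (pp_finite a b 0).toFinset = {0} := by
    ext π
    simp only [Set.Finite.mem_toFinset, Set.mem_ofPred_eq, mem_singleton]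
    constructor
    · rintro ⟨_, _, h3, _⟩
      funext i j
      exact Nat.le_zero.mp (h3 i j)
    · rintro rfl
      exact ⟨by simp, by simp, by simp, by simp⟩
  rw [ppGF_eq, this]
  simp [ppSize]

lemma strip {u v : PowerSeries ℤ} {A B : ℕ} (hu : constantCoeff u = 1) (hv : constantCoeff v = 1)
    (h : X ^ A * u = X ^ B * v) : u = v := by
  have key : ∀ {u v : PowerSeries ℤ} {A B : ℕ}, constantCoeff u = 1 →
      X ^ A * u = X ^ B * v → B ≤ A := by
    intro u v A B hu h
    by_contra hlt
    have h1 := congrArg (coeff A) h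
    rw [coeff_X_pow_mul', coeff_X_pow_mul', if_pos le_rfl, if_neg hlt] at h1
    simp [hu] at h1
  have hAB : A = B := le_antisymm (key hv h.symm) (key hu h)
  subst hAB
  exact mul_left_cancel₀ (pow_ne_zero _ X_ne_zero) h

def cross (a b c : ℕ) : PowerSeries ℤ :=
  ∏ i ∈ range a, ∏ j ∈ range b, (1 - (X : PowerSeries ℤ) ^ (i + j + c + 1))

lemma cross_const (a b c : ℕ) : constantCoeff (cross a b c) = 1 := by
  simp [cross, map_prod]

/-- Group factor of the Vandermonde product. -/
def grp (n s : ℕ) : PowerSeries ℤ :=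
  ∏ i : Fin n, ∏ j : Fin n, if i < j then (X : PowerSeries ℤ)^(s + (n - 1 - j)) - X^(s + (n - 1 - i)) else 1

lemma grp_ne (n s : ℕ) : grp n s ≠ 0 := by
  unfold grp
  rw [Finset.prod_ne_zero_iff]
  intro i _
  rw [Finset.prod_ne_zero_iff]
  intro j _
  split_ifs with h
  · rw [sub_ne_zero]
    intro e
    have := congrArg (coeff (s + (n - 1 - j))) e
    rw [coeff_X_pow_self, coeff_X_pow, if_neg] at this
    · simp at this
    · have := Fin.lt_def.mp h
      omega
  · exact one_ne_zero

lemma cross_eq (a b c : ℕ) : cross a b c =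
    ∏ i : Fin a, ∏ j : Fin b, (1 - (X : PowerSeries ℤ) ^ (c + a + j - i)) := by
  unfold cross
  rw [← Finset.prod_range_reflect, Finset.prod_range]
  refine Finset.prod_congr rfl fun i _ => ?_
  rw [Finset.prod_range]
  refine Finset.prod_congr rfl fun j _ => ?_
  congr 2
  omega

lemma vand_eq (a b : ℕ) : ∃ W : PowerSeries ℤ, W ≠ 0 ∧ ∀ c, ∃ N : ℕ,
    (Matrix.vandermonde (fun i => (X : PowerSeries ℤ) ^ topRow a b c i)).det
      = X ^ N * W * cross a b c := by
  refine ⟨grp a b * grp b 0, mul_ne_zero (grp_ne _ _) (grp_ne _ _), fun c => ?_⟩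
  refine ⟨(∑ i : Fin a, ∑ j : Fin a, if i < j then c else 0)
    + ∑ i : Fin a, ∑ j : Fin b, (b - 1 - j), ?_⟩
  rw [Matrix.det_vandermonde]
  have h0 : ∀ i : Fin (a+b), ∏ j ∈ Finset.Ioi i,
      ((X : PowerSeries ℤ) ^ topRow a b c j - X ^ topRow a b c i)
      = ∏ j : Fin (a+b), if i < j then (X : PowerSeries ℤ) ^ topRow a b c j - X ^ topRow a b c i
        else 1 := by
    intro i
    rw [← Finset.prod_filter]
    congr 1
    ext j; simp
  rw [Finset.prod_congr rfl fun i _ => h0 i, Fin.prod_univ_add]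
  simp only [Fin.prod_univ_add]
  have t1 : ∀ i : Fin a, topRow a b c (Fin.castAdd b i) = c + (b + (a - 1 - i)) := by
    intro i
    have := i.2
    simp only [topRow, Fin.val_castAdd, if_pos i.2]
    omega
  have t2 : ∀ i : Fin b, topRow a b c (Fin.natAdd a i) = 0 + (b - 1 - i) := by
    intro i
    have := i.2
    simp only [topRow, Fin.val_natAdd]
    rw [if_neg (by omega)]
    omega
  have g1 : ∏ i : Fin a, ∏ j : Fin a, (if Fin.castAdd b i < Fin.castAdd b j then
      (X : PowerSeries ℤ) ^ topRow a b c (Fin.castAdd b j) - X ^ topRow a b c (Fin.castAdd b i) else 1)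
      = X ^ (∑ i : Fin a, ∑ j : Fin a, if i < j then c else 0) * grp a b := by
    rw [grp, ← Finset.prod_pow_eq_pow_sum, ← Finset.prod_mul_distrib]
    refine Finset.prod_congr rfl fun i _ => ?_
    rw [← Finset.prod_pow_eq_pow_sum, ← Finset.prod_mul_distrib]
    refine Finset.prod_congr rfl fun j _ => ?_
    rw [t1, t1]
    simp only [Fin.lt_def, Fin.val_castAdd]
    split_ifs
    · rw [pow_add X c, pow_add X c]; ring
    · simp
  have g2 : ∏ i : Fin b, ∏ j : Fin b, (if Fin.natAdd a i < Fin.natAdd a j then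
      (X : PowerSeries ℤ) ^ topRow a b c (Fin.natAdd a j) - X ^ topRow a b c (Fin.natAdd a i) else 1)
      = grp b 0 := by
    rw [grp]
    refine Finset.prod_congr rfl fun i _ => ?_
    refine Finset.prod_congr rfl fun j _ => ?_
    rw [t2, t2]
    simp only [Fin.lt_def, Fin.val_natAdd, Nat.add_lt_add_iff_left]
  have g3 : ∏ i : Fin a, ∏ j : Fin b, (if Fin.castAdd b i < Fin.natAdd a j then
      (X : PowerSeries ℤ) ^ topRow a b c (Fin.natAdd a j) - X ^ topRow a b c (Fin.castAdd b i) else 1)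
      = X ^ (∑ i : Fin a, ∑ j : Fin b, (b - 1 - (j : ℕ))) * cross a b c := by
    rw [cross_eq, ← Finset.prod_pow_eq_pow_sum, ← Finset.prod_mul_distrib]
    refine Finset.prod_congr rfl fun i _ => ?_
    rw [← Finset.prod_pow_eq_pow_sum, ← Finset.prod_mul_distrib]
    refine Finset.prod_congr rfl fun j _ => ?_
    have hi := i.2
    have hj := j.2
    rw [t1, t2, if_pos (by rw [Fin.lt_def, Fin.val_castAdd, Fin.val_natAdd]; omega), mul_sub,
      ← pow_add, mul_one, zero_add]
    congr 2
    omega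
  have g4 : ∏ i : Fin b, ∏ j : Fin a, (if Fin.natAdd a i < Fin.castAdd b j then
      (X : PowerSeries ℤ) ^ topRow a b c (Fin.castAdd b j) - X ^ topRow a b c (Fin.natAdd a i) else 1)
      = 1 := by
    refine Finset.prod_eq_one fun i _ => Finset.prod_eq_one fun j _ => ?_
    rw [if_neg]
    rw [Fin.lt_def, Fin.val_castAdd, Fin.val_natAdd]; omega
  rw [Finset.prod_mul_distrib, Finset.prod_mul_distrib, g1, g2, g3, g4, pow_add]
  ring

theorem stmt5 (a b c : ℕ) :
    (PowerSeries.mk fun n =>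
        (Nat.card {π : ℕ → ℕ → ℕ // IsBoxPP a b c π ∧ ppSize a b π = n} : ℤ))
        * (∏ i ∈ range a, ∏ j ∈ range b, (1 - (X : PowerSeries ℤ) ^ (i + j + 1)))
      = ∏ i ∈ range a, ∏ j ∈ range b, (1 - (X : PowerSeries ℤ) ^ (i + j + c + 1)) := by
  change ppGF a b c * cross a b 0 = cross a b c
  obtain ⟨W, hW, h⟩ := vand_eq a b
  obtain ⟨N, hN⟩ := h c
  obtain ⟨M, hM⟩ := h 0
  have e1 := ppGF_det a b c
  have e0 := ppGF_det a b 0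
  rw [ppGF_zero, hM, Finset.prod_pow_eq_pow_sum] at e0
  rw [hN, Finset.prod_pow_eq_pow_sum] at e1
  generalize gwt (a+b) (ppMap a b c 0) = A at *
  generalize gwt (a+b) (ppMap a b 0 0) = A0 at *
  generalize ∏ k ∈ range (a+b), ∏ j ∈ range k, (1 - (X : PowerSeries ℤ)^(j+1)) = D at *
  generalize ∑ i, topRow a b c i = S at *
  generalize ∑ i, topRow a b 0 i = S0 at *
  refine strip (A := A + S0 + M) (B := A0 + S + N) (by simp [ppGF_const, cross_const])
    (cross_const _ _ _) ?_
  refine mul_left_cancel₀ hW ?_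
  simp only [pow_add]
  linear_combination (X ^ A0) * e1 - (X ^ A * ppGF a b c) * e0

end
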